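/- arXiv:0707.3628 — 9 statements merged into one kernel-verified Lean document; each statement's English description precedes it below -/
import Mathlib

section
/- For all real numbers x, y, z with cos(π/14) ≤ x, y, z ≤ 1, define f₁(x,y,z) := −3·(4(x²+y²+z²) − 3)² + (16xyz)². Then 31 < 4·f₁(x,y,z) ≤ 52. -/
open Real

/-- The polynomial `-3(4(a+b+c)-3)² + 256abc` is increasing in `a` on `[19/20, 1]³`. -/
lemma discriminant_mono_left {a a' b c : ℝ} (haa' : a ≤ a') (ha' : a' ≤ 1)
    (hb : 19 / 20 ≤ b) (hb' : b ≤ 1) (hc : 19 / 20 ≤ c) (hc' : c ≤ 1) :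
    -3 * (4 * (a + b + c) - 3) ^ 2 + 256 * (a * b * c) ≤
      -3 * (4 * (a' + b + c) - 3) ^ 2 + 256 * (a' * b * c) := by
  have hbc : 19 / 20 * (19 / 20) ≤ b * c := by gcongr
  have hslope : 0 ≤ 256 * (b * c) - 12 * (4 * (a + a') + 8 * (b + c) - 6) := by linarith
  linear_combination mul_nonneg (sub_nonneg.2 haa') hslope

/-- Monotonicity of `-3(4(a+b+c)-3)² + 256abc` in all three variables on `[19/20, 1]³`. -/
lemma discriminant_mono {a a' b b' c c' : ℝ}
    (haa' : a ≤ a') (hbb' : b ≤ b') (hcc' : c ≤ c')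
    (ha : 19 / 20 ≤ a) (hb : 19 / 20 ≤ b) (hc : 19 / 20 ≤ c)
    (ha' : a' ≤ 1) (hb' : b' ≤ 1) (hc' : c' ≤ 1) :
    -3 * (4 * (a + b + c) - 3) ^ 2 + 256 * (a * b * c) ≤
      -3 * (4 * (a' + b' + c') - 3) ^ 2 + 256 * (a' * b' * c') := by
  have h₁ := discriminant_mono_left haa' ha' hb (hbb'.trans hb') hc (hcc'.trans hc')
  have h₂ := discriminant_mono_left hbb' hb' (ha.trans haa') ha' hc (hcc'.trans hc')
  have h₃ := discriminant_mono_left hcc' hc' (ha.trans haa') ha' (hb.trans hbb') hb'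
  linear_combination h₁ + h₂ + h₃

lemma sq_mem_Icc_of_cos_pi_div_fourteen_le {x : ℝ} (hx : Real.cos (π / 14) ≤ x) (hx' : x ≤ 1) :
    19 / 20 ≤ x ^ 2 ∧ x ^ 2 ≤ 1 := by
  have hcos := Real.one_sub_sq_div_two_le_cos (x := π / 14)
  have hpi : π ^ 2 ≤ 3.1416 ^ 2 := by
    gcongr
    exact Real.pi_lt_d4.le
  have hlow : 0.9748 ≤ x := by linarith
  constructor <;> nlinarith

/-- Lemma 4.1 (1): for `cos(π/14) ≤ x, y, z ≤ 1`,
`31 < 4·(−3(4(x²+y²+z²)−3)² + (16xyz)²) ≤ 52`. -/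
theorem lemma41_1 (x y z : ℝ)
    (hx : Real.cos (π / 14) ≤ x) (hx' : x ≤ 1)
    (hy : Real.cos (π / 14) ≤ y) (hy' : y ≤ 1)
    (hz : Real.cos (π / 14) ≤ z) (hz' : z ≤ 1) :
    31 < 4 * (-3 * (4 * (x ^ 2 + y ^ 2 + z ^ 2) - 3) ^ 2 + (16 * x * y * z) ^ 2) ∧
    4 * (-3 * (4 * (x ^ 2 + y ^ 2 + z ^ 2) - 3) ^ 2 + (16 * x * y * z) ^ 2) ≤ 52 := by
  obtain ⟨ha, ha'⟩ := sq_mem_Icc_of_cos_pi_div_fourteen_le hx hx'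
  obtain ⟨hb, hb'⟩ := sq_mem_Icc_of_cos_pi_div_fourteen_le hy hy'
  obtain ⟨hc, hc'⟩ := sq_mem_Icc_of_cos_pi_div_fourteen_le hz hz'
  have hlower := discriminant_mono ha hb hc le_rfl le_rfl le_rfl ha' hb' hc'
  have hupper := discriminant_mono ha' hb' hc' ha hb hc le_rfl le_rfl le_rfl
  have hprod : (16 * x * y * z) ^ 2 = 256 * (x ^ 2 * y ^ 2 * z ^ 2) := by ring
  rw [hprod]
  constructor <;> linarith
end

section
/- For all real numbers x, y, z with cos(π/14) ≤ x, y, z ≤ 1, define f₂(x,y,z) := −(4(x²+y²+z²) − 3)² + 3·(4(x²+y²+z²) − 3) + (8xyz)² − 9. Then f₂(x,y,z) > 0.5. -/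
open Real

lemma sq_bounds_of_cos_pi_div_fourteen_le {x : ℝ} (hx : Real.cos (π / 14) ≤ x) (hx' : x ≤ 1) :
    0 ≤ 1 - x ^ 2 ∧ 0 ≤ x ^ 2 - 0.95 := by
  have hcos := Real.one_sub_sq_div_two_le_cos (x := π / 14)
  have hx0 : 0.9747 ≤ x := by nlinarith [Real.pi_lt_d4, Real.pi_pos]
  constructor <;> nlinarith

/-- The inequality in the squared variables. Bounding each square by its chord leaves a
multi-affine polynomial, which is determined by its values at the vertices of the cube. -/
lemma lt_cubic_of_mem_Icc {a b c : ℝ} (ha' : 0 ≤ 1 - a) (ha : 0 ≤ a - 0.95)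
    (hb' : 0 ≤ 1 - b) (hb : 0 ≤ b - 0.95) (hc' : 0 ≤ 1 - c) (hc : 0 ≤ c - 0.95) :
    0.5 < -(4 * (a + b + c) - 3) ^ 2 + 3 * (4 * (a + b + c) - 3) + 64 * (a * b * c) - 9 := by
  linarith [mul_nonneg ha ha', mul_nonneg hb hb', mul_nonneg hc hc',
    mul_nonneg (mul_nonneg ha hb) hc, mul_nonneg (mul_nonneg ha hb) hc',
    mul_nonneg (mul_nonneg ha hb') hc, mul_nonneg (mul_nonneg ha hb') hc',
    mul_nonneg (mul_nonneg ha' hb) hc, mul_nonneg (mul_nonneg ha' hb) hc',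
    mul_nonneg (mul_nonneg ha' hb') hc, mul_nonneg (mul_nonneg ha' hb') hc']

/-- Lemma 4.1 (3): for `cos(π/14) ≤ x, y, z ≤ 1`,
`−(4(x²+y²+z²)−3)² + 3(4(x²+y²+z²)−3) + (8xyz)² − 9 > 0.5`. -/
theorem lemma41_3 (x y z : ℝ)
    (hx : Real.cos (π / 14) ≤ x) (hx' : x ≤ 1)
    (hy : Real.cos (π / 14) ≤ y) (hy' : y ≤ 1)
    (hz : Real.cos (π / 14) ≤ z) (hz' : z ≤ 1) :
    0.5 < -(4 * (x ^ 2 + y ^ 2 + z ^ 2) - 3) ^ 2 + 3 * (4 * (x ^ 2 + y ^ 2 + z ^ 2) - 3)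
      + (8 * x * y * z) ^ 2 - 9 := by
  obtain ⟨ha', ha⟩ := sq_bounds_of_cos_pi_div_fourteen_le hx hx'
  obtain ⟨hb', hb⟩ := sq_bounds_of_cos_pi_div_fourteen_le hy hy'
  obtain ⟨hc', hc⟩ := sq_bounds_of_cos_pi_div_fourteen_le hz hz'
  have hprod : (8 * x * y * z) ^ 2 = 64 * (x ^ 2 * y ^ 2 * z ^ 2) := by ring
  rw [hprod]
  exact lt_cubic_of_mem_Icc ha' ha hb' hb hc' hc
end

section
/- For all real numbers x, y, z with cos(π/14) ≤ x, y, z ≤ 1, define f₃(x,y,z) := −3·(4(x²+y²+z²) − 3) + 32xyz. Then 2·f₃(x,y,z) > 8.8. -/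
open Real

theorem cos_pi_div_fourteen_gt : 0.974 < Real.cos (π / 14) := by
  have h := Real.one_sub_sq_div_two_le_cos (x := π / 14)
  nlinarith [Real.pi_lt_d4, Real.pi_pos]

/-- The cubic is increasing in its first variable on `[0.974, 1]³`. -/
theorem cubic_le_of_fst_ge {x y z : ℝ} (hx : 0.974 ≤ x) (hx' : x ≤ 1)
    (hy : 0.974 ≤ y) (hz : 0.974 ≤ z) :
    -12 * (0.974 : ℝ) ^ 2 + 32 * 0.974 * y * z ≤ -12 * x ^ 2 + 32 * x * y * z := by
  have hyz : (0.974 : ℝ) * 0.974 ≤ y * z := mul_le_mul hy hz (by norm_num) (by linarith)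
  have h : 0 ≤ (x - 0.974) * (32 * (y * z) - 12 * (x + 0.974)) :=
    mul_nonneg (by linarith) (by linarith)
  linarith

/-- Lemma 4.1 (4): for `cos(π/14) ≤ x, y, z ≤ 1`,
`2·(−3(4(x²+y²+z²)−3) + 32xyz) > 8.8`. -/
theorem lemma41_4 (x y z : ℝ)
    (hx : Real.cos (π / 14) ≤ x) (hx' : x ≤ 1)
    (hy : Real.cos (π / 14) ≤ y) (hy' : y ≤ 1)
    (hz : Real.cos (π / 14) ≤ z) (hz' : z ≤ 1) :
    8.8 < 2 * (-3 * (4 * (x ^ 2 + y ^ 2 + z ^ 2) - 3) + 32 * x * y * z) := by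
  have hc := cos_pi_div_fourteen_gt
  have h₁ := cubic_le_of_fst_ge (hc.le.trans hx) hx' (hc.le.trans hy) (hc.le.trans hz)
  have h₂ := cubic_le_of_fst_ge (hc.le.trans hy) hy' (hc.le.trans hz) (le_refl (0.974 : ℝ))
  have h₃ := cubic_le_of_fst_ge (hc.le.trans hz) hz' (le_refl (0.974 : ℝ)) (le_refl (0.974 : ℝ))
  linarith
end

section
/- For all real numbers x, y, z with cos(π/14) ≤ x, y, z ≤ 1, define f₄(x,y,z) := 3·(4(x²+y²+z²) − 3)² − 12·(z² + 4x²y² − 1)·(4(x²+y²+z²) − 3) + 16·(z² + 4x²y² − 1)² − (8xyz)². Then f₄(x,y,z) > 0.1. -/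
open Real

/-- `cos (π / 7)` is a root of `8 t ^ 3 - 4 t ^ 2 - 4 t + 1`. -/
lemma cos_pi_div_seven_root :
    8 * cos (π / 7) ^ 3 - 4 * cos (π / 7) ^ 2 - 4 * cos (π / 7) + 1 = 0 := by
  have hpos : 0 < cos (π / 7) :=
    cos_pos_of_mem_Ioo ⟨by linarith [pi_pos], by linarith [pi_pos]⟩
  have h3 := cos_three_mul (π / 7)
  have h4 : cos (4 * (π / 7)) = 2 * (2 * cos (π / 7) ^ 2 - 1) ^ 2 - 1 := by
    rw [← cos_two_mul, ← cos_two_mul]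
    ring_nf
  have h : cos (4 * (π / 7)) = -cos (3 * (π / 7)) := by
    rw [← cos_pi_sub]
    ring_nf
  have hne : cos (π / 7) + 1 ≠ 0 := by linarith
  apply mul_left_cancel₀ hne
  linear_combination h - h4 - h3

lemma lt_cos_pi_div_seven : 0.900964 < cos (π / 7) := by
  have hlow : 0.89 ≤ cos (π / 7) := by
    have h := one_sub_sq_div_two_le_cos (x := π / 7)
    nlinarith [pi_pos, pi_lt_d2]
  have hroot := cos_pi_div_seven_root
  by_contra! h
  nlinarith [mul_nonneg (sub_nonneg.2 hlow) (sub_nonneg.2 h),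
    mul_nonneg (mul_nonneg (sub_nonneg.2 hlow) (sub_nonneg.2 hlow)) (sub_nonneg.2 h)]

lemma lt_cos_pi_div_fourteen_sq : 0.950482 < cos (π / 14) ^ 2 := by
  have h := cos_sq (π / 14)
  rw [show 2 * (π / 14) = π / 7 by ring] at h
  linarith [lt_cos_pi_div_seven]

/-- The bound in terms of the squares `a = x ^ 2`, `b = y ^ 2`, `d = z ^ 2`. -/
lemma one_tenth_lt_of_squares {a b d : ℝ} (ha : 0.950482 ≤ a) (ha' : a ≤ 1)
    (hb : 0.950482 ≤ b) (hb' : b ≤ 1) (hd : d ≤ 1) :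
    0.1 < 3 * (4 * (a + b + d) - 3) ^ 2
      - 12 * (d + 4 * a * b - 1) * (4 * (a + b + d) - 3)
      + 16 * (d + 4 * a * b - 1) ^ 2 - 64 * a * b * d := by
  have hab : 0 ≤ (1 - a) * (1 - b) := mul_nonneg (by linarith) (by linarith)
  have hone : 0.1 < 48 * (a + b) ^ 2 + 24 * (a + b) + 3 - 192 * (a * b) * (a + b)
      - 112 * (a * b) + 256 * (a * b) ^ 2 := by
    obtain ⟨u, rfl⟩ : ∃ u, a = 0.950482 + u := ⟨a - 0.950482, by ring⟩
    obtain ⟨v, rfl⟩ : ∃ v, b = 0.950482 + v := ⟨b - 0.950482, by ring⟩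
    have hu : 0 ≤ u := by linarith
    have hv : 0 ≤ v := by linarith
    nlinarith [mul_nonneg hu hv, mul_nonneg hu hu, mul_nonneg hv hv,
      mul_nonneg (mul_nonneg hu hv) hu, mul_nonneg (mul_nonneg hu hv) hv,
      sq_nonneg (u * v)]
  have hmono : 0 ≤ (1 - d) * (128 * (a * b) - 48 * (a + b) - 16 * (d + 1) + 20) :=
    mul_nonneg (by linarith) (by nlinarith)
  linear_combination hone + hmono

/-- Lemma 4.1 (5): for `cos(π/14) ≤ x, y, z ≤ 1`,
`3(4(x²+y²+z²)−3)² − 12(z²+4x²y²−1)(4(x²+y²+z²)−3) + 16(z²+4x²y²−1)² − (8xyz)² > 0.1`. -/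
theorem lemma41_5 (x y z : ℝ)
    (hx : Real.cos (π / 14) ≤ x) (hx' : x ≤ 1)
    (hy : Real.cos (π / 14) ≤ y) (hy' : y ≤ 1)
    (hz : Real.cos (π / 14) ≤ z) (hz' : z ≤ 1) :
    0.1 < 3 * (4 * (x ^ 2 + y ^ 2 + z ^ 2) - 3) ^ 2
      - 12 * (z ^ 2 + 4 * x ^ 2 * y ^ 2 - 1) * (4 * (x ^ 2 + y ^ 2 + z ^ 2) - 3)
      + 16 * (z ^ 2 + 4 * x ^ 2 * y ^ 2 - 1) ^ 2 - (8 * x * y * z) ^ 2 := by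
  have hc : 0 < cos (π / 14) :=
    cos_pos_of_mem_Ioo ⟨by linarith [pi_pos], by linarith [pi_pos]⟩
  have lower {t : ℝ} (ht : cos (π / 14) ≤ t) : 0.950482 ≤ t ^ 2 :=
    lt_cos_pi_div_fourteen_sq.le.trans (pow_le_pow_left₀ hc.le ht 2)
  have upper {t : ℝ} (ht : cos (π / 14) ≤ t) (ht' : t ≤ 1) : t ^ 2 ≤ 1 :=
    pow_le_one₀ (hc.le.trans ht) ht'
  have key := one_tenth_lt_of_squares (lower hx) (upper hx hx') (lower hy) (upper hy hy')
    (upper hz hz')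
  linear_combination key
end

section
/- For all real numbers x, y, z with cos(π/4) ≤ x ≤ y ≤ z ≤ 1, one has 2(x² + y² − 2x²y²) + z² − 1 ≥ 0. -/
open Real

/-- Lemma 4.3 (1): for `cos(π/4) ≤ x ≤ y ≤ z ≤ 1`,
`2(x² + y² − 2x²y²) + z² − 1 ≥ 0`. -/
theorem lemma43_1 (x y z : ℝ)
    (hx : Real.cos (π / 4) ≤ x) (hxy : x ≤ y) (hyz : y ≤ z) (hz : z ≤ 1) :
    0 ≤ 2 * (x ^ 2 + y ^ 2 - 2 * x ^ 2 * y ^ 2) + z ^ 2 - 1 := by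
  have hx2 : 1 / 2 ≤ x ^ 2 := by
    rw [Real.cos_pi_div_four] at hx
    have h := pow_le_pow_left₀ (by positivity) hx 2
    rw [div_pow, Real.sq_sqrt (by norm_num)] at h
    linarith
  have hx0 : 0 ≤ x := (Real.cos_pi_div_four ▸ by positivity : 0 ≤ Real.cos (π / 4)).trans hx
  have hxy2 : x ^ 2 ≤ y ^ 2 := by gcongr
  have hyz2 : y ^ 2 ≤ z ^ 2 := pow_le_pow_left₀ (hx0.trans hxy) hyz 2
  have hz2 : z ^ 2 ≤ 1 := pow_le_one₀ (hx0.trans (hxy.trans hyz)) hz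
  have h₁ : 0 ≤ (y ^ 2 - x ^ 2) * (4 * y ^ 2 - 2) := mul_nonneg (by linarith) (by linarith)
  have h₂ : 0 ≤ (1 - y ^ 2) * (4 * y ^ 2 - 1) := mul_nonneg (by linarith) (by linarith)
  linarith
end

section
/- For all real numbers x, y, z with cos(π/4) ≤ x ≤ cos(π/8) and x ≤ y ≤ z ≤ 1, one has 8(x² + y² − 2x²y²) + 4z² − 5 > 0.1. -/
open Real

/-- Lemma 4.3 (2): for `cos(π/4) ≤ x ≤ cos(π/8)` and `x ≤ y ≤ z ≤ 1`,
`8(x² + y² − 2x²y²) + 4z² − 5 > 0.1`. -/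
theorem lemma43_2 (x y z : ℝ)
    (hx : Real.cos (π / 4) ≤ x) (hx' : x ≤ Real.cos (π / 8))
    (hxy : x ≤ y) (hyz : y ≤ z) (hz : z ≤ 1) :
    0.1 < 8 * (x ^ 2 + y ^ 2 - 2 * x ^ 2 * y ^ 2) + 4 * z ^ 2 - 5 := by
  have hcos : 0 < Real.cos (π / 4) := by rw [cos_pi_div_four]; positivity
  have hcos_sq : Real.cos (π / 4) ^ 2 = 1 / 2 := by
    rw [cos_pi_div_four, div_pow, sq_sqrt zero_le_two]; norm_num
  have hcos_sq' : Real.cos (π / 8) ^ 2 < 0.86 := by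
    have hsqrt : √2 < 1.42 := (sqrt_lt' (by norm_num)).2 (by norm_num)
    rw [cos_sq, show 2 * (π / 8) = π / 4 by ring, cos_pi_div_four]
    linarith
  have hx0 : 0 < x := hcos.trans_le hx
  have hy0 : 0 < y := hx0.trans_le hxy
  have hxl : 1 / 2 ≤ x ^ 2 := hcos_sq ▸ pow_le_pow_left₀ hcos.le hx 2
  have hxu : x ^ 2 < 0.86 := (pow_le_pow_left₀ hx0.le hx' 2).trans_lt hcos_sq'
  have hxy2 : x ^ 2 ≤ y ^ 2 := pow_le_pow_left₀ hx0.le hxy 2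
  have hyz2 : y ^ 2 ≤ z ^ 2 := pow_le_pow_left₀ hy0.le hyz 2
  have hy1 : y ^ 2 ≤ 1 := pow_le_one₀ hy0.le (hyz.trans hz)
  -- The lower bound obtained from `y ^ 2 ≤ z ^ 2` is affine in `y ^ 2`, with slope `12 - 16 * x ^ 2`.
  rcases le_total (x ^ 2) (3 / 4) with h | h
  · linarith [mul_nonneg (sub_nonneg.2 h) (sub_nonneg.2 hxy2),
      mul_nonneg (sub_nonneg.2 h) (sub_nonneg.2 hxl)]
  · linarith [mul_nonneg (sub_nonneg.2 h) (sub_nonneg.2 hy1)]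
end

section
/- Let x = cos(π/9) and let y, z be real numbers with cos(π/9) ≤ y ≤ z ≤ 1. Define g₃(y,z) := −27·(4(x²+y²+z²) − 3)² − 54·(4(x²+y²+z²) − 3) + 52·(8xyz)² − 27. Then g₃(y,z) > 296. -/
open Real

/-- A rational lower bound, from the triple-angle formula `4 c ^ 3 - 3 c = 1 / 2`. -/
lemma cos_pi_div_nine_gt : 0.93969 < Real.cos (π / 9) := by
  have triple : 4 * Real.cos (π / 9) ^ 3 - 3 * Real.cos (π / 9) = 1 / 2 := by
    rw [← Real.cos_three_mul, ← Real.cos_pi_div_three]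
    congr 1
    ring
  have half_lt : 1 / 2 < Real.cos (π / 9) := by
    rw [← Real.cos_pi_div_three]
    apply Real.cos_lt_cos_of_nonneg_of_le_pi <;> linarith [Real.pi_pos]
  by_contra! h
  nlinarith [mul_nonneg (sub_nonneg.2 half_lt.le) (sub_nonneg.2 h)]

/-- The polynomial inequality in the squares `a, b, c` of the three cosines. -/
lemma discriminant_gt_of_mem_Icc {a b c : ℝ} (ha : 0.883017 ≤ a) (hb : 0.883017 ≤ b)
    (hc : 0.883017 ≤ c) (ha₁ : a ≤ 1) (hb₁ : b ≤ 1) (hc₁ : c ≤ 1) :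
    296 < -27 * (4 * (a + b + c) - 2) ^ 2 + 3328 * (a * b * c) := by
  obtain ⟨u, rfl⟩ : ∃ u, a = 0.883017 + u := ⟨a - 0.883017, by ring⟩
  obtain ⟨v, rfl⟩ : ∃ v, b = 0.883017 + v := ⟨b - 0.883017, by ring⟩
  obtain ⟨w, rfl⟩ : ∃ w, c = 0.883017 + w := ⟨c - 0.883017, by ring⟩
  have hu : 0 ≤ u := by linarith
  have hv : 0 ≤ v := by linarith
  have hw : 0 ≤ w := by linarith
  have sum_le : u + v + w ≤ 0.36 := by linarith
  have sum_nonneg : 0 ≤ u + v + w := by positivity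
  nlinarith [mul_nonneg sum_nonneg (sub_nonneg.2 sum_le), mul_nonneg hu hv,
    mul_nonneg hv hw, mul_nonneg hu hw, mul_nonneg (mul_nonneg hu hv) hw]

/-- Lemma 4.3 (3): for `x = cos(π/9)` and `cos(π/9) ≤ y ≤ z ≤ 1`,
`−27(4(x²+y²+z²)−3)² − 54(4(x²+y²+z²)−3) + 52(8xyz)² − 27 > 296`. -/
theorem lemma43_3 (x y z : ℝ) (hx : x = Real.cos (π / 9))
    (hy : Real.cos (π / 9) ≤ y) (hyz : y ≤ z) (hz : z ≤ 1) :
    296 < -27 * (4 * (x ^ 2 + y ^ 2 + z ^ 2) - 3) ^ 2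
      - 54 * (4 * (x ^ 2 + y ^ 2 + z ^ 2) - 3) + 52 * (8 * x * y * z) ^ 2 - 27 := by
  have hc := cos_pi_div_nine_gt
  have key := discriminant_gt_of_mem_Icc (a := x ^ 2) (b := y ^ 2) (c := z ^ 2)
    (by nlinarith) (by nlinarith) (by nlinarith) (by nlinarith) (by nlinarith) (by nlinarith)
  linarith
end

section
/- Let x = cos(π/9) and let y, z be real numbers with cos(π/9) ≤ y ≤ z ≤ 1. Define g₄(y,z) := 2·(z² + 4x²y² − 1) − (4(x²+y²+z²) − 3) − (79 − 50√10)/169. Then g₄(y,z) < −0.9. -/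
open Real

/-- Lemma 4.3 (4): for `x = cos(π/9)` and `cos(π/9) ≤ y ≤ z ≤ 1`,
`2(z²+4x²y²−1) − (4(x²+y²+z²)−3) − (79−50√10)/169 < −0.9`. -/
theorem lemma43_4 (x y z : ℝ) (hx : x = Real.cos (π / 9))
    (hy : Real.cos (π / 9) ≤ y) (hyz : y ≤ z) (hz : z ≤ 1) :
    2 * (z ^ 2 + 4 * x ^ 2 * y ^ 2 - 1) - (4 * (x ^ 2 + y ^ 2 + z ^ 2) - 3)
      - (79 - 50 * Real.sqrt 10) / 169 < -0.9 := by
  have hx_pos : 0 < x := by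
    rw [hx]
    exact cos_pos_of_mem_Ioo ⟨by linarith [pi_pos], by linarith [pi_pos]⟩
  have h_cubic : x * (4 * x ^ 2 - 3) = 1 / 2 := by
    have h := cos_three_mul (π / 9)
    rw [show 3 * (π / 9) = π / 3 by ring, cos_pi_div_three, ← hx] at h
    linarith
  have h_low : 0 < 4 * x ^ 2 - 3 :=
    pos_of_mul_pos_right (by rw [h_cubic]; norm_num) hx_pos.le
  have h_up : x < 0.945 := by
    by_contra! h
    nlinarith [mul_le_mul h h (by norm_num) hx_pos.le]
  have h_sqrt : Real.sqrt 10 < 3.17 := by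
    rw [sqrt_lt' (by norm_num)]
    norm_num
  have hy_pos : 0 < y := by linarith
  have h_yz : y ^ 2 ≤ z ^ 2 := by gcongr
  have hy_sq : y ^ 2 ≤ 1 := pow_le_one₀ hy_pos.le (hyz.trans hz)
  have hx_sq : x ^ 2 < 0.9 := by nlinarith
  nlinarith [mul_nonneg h_low.le (sub_nonneg.2 hy_sq)]
end

section
/- Let x = cos(π/9) and let y, z be real numbers with cos(π/9) ≤ y ≤ z ≤ 1. Define g₅(y,z) := 25·((4xyz)² − (z² + 4x²y² − 1)²) − 27·(2y²(1 − 2x²) + 2x² + z²)². Then g₅(y,z) > 0.2. -/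
open Real

theorem cos_pi_div_nine_sq_bounds :
    0.88302 < cos (π / 9) ^ 2 ∧ cos (π / 9) ^ 2 < 0.883025 := by
  have hcubic : 4 * cos (π / 9) ^ 3 - 3 * cos (π / 9) = 1 / 2 := by
    rw [← cos_three_mul, ← cos_pi_div_three]
    congr 1
    ring
  have hhalf : 1 / 2 < cos (π / 9) := by
    rw [← cos_pi_div_three]
    apply cos_lt_cos_of_nonneg_of_le_pi <;> linarith [pi_pos]
  generalize cos (π / 9) = x at *
  have hlo : 0.93969 < x := by
    by_contra! h
    nlinarith [mul_nonneg (sub_nonneg.2 h) (sub_nonneg.2 hhalf.le),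
      mul_nonneg (mul_nonneg (sub_nonneg.2 h) (sub_nonneg.2 hhalf.le)) (sub_nonneg.2 hhalf.le)]
  have hhi : x < 0.939694 := by
    by_contra! h
    nlinarith [mul_nonneg (sub_nonneg.2 h) (sub_nonneg.2 h),
      mul_nonneg (mul_nonneg (sub_nonneg.2 h) (sub_nonneg.2 h)) (sub_nonneg.2 h)]
  constructor <;> nlinarith

/-- In the variables `a = x²`, `Y = y²`, `Z = z²` the expression is a concave quadratic function
of `(Y, Z)`, so it is bounded below by its values at the vertices of the triangle
`a ≤ Y ≤ Z ≤ 1`. -/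
theorem lt_quadratic_of_mem_triangle {a Y Z : ℝ} (ha : 0.88302 < a) (ha' : a < 0.883025)
    (hY : a ≤ Y) (hYZ : Y ≤ Z) (hZ : Z ≤ 1) :
    0.2 < 25 * (16 * a * Y * Z - (Z + 4 * a * Y - 1) ^ 2)
      - 27 * (2 * Y * (1 - 2 * a) + 2 * a + Z) ^ 2 := by
  set g : ℝ → ℝ → ℝ := fun Y Z ↦ 25 * (16 * a * Y * Z - (Z + 4 * a * Y - 1) ^ 2)
    - 27 * (2 * Y * (1 - 2 * a) + 2 * a + Z) ^ 2
  change 0.2 < g Y Z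
  have h₁ : 0.2 < g a a := by
    have e : g a a = 25 * (16 * a ^ 3 - (a + 4 * a ^ 2 - 1) ^ 2)
        - 27 * (5 * a - 4 * a ^ 2) ^ 2 := by simp only [g]; ring
    have hp : 0.77972 < a ^ 2 ∧ a ^ 2 < 0.77974 := by constructor <;> nlinarith
    have hc : 0.6885 < a ^ 3 := by nlinarith
    have hs : (a + 4 * a ^ 2 - 1) ^ 2 < 3.00199 ^ 2 := by
      apply pow_lt_pow_left₀ <;> linarith
    have ht : (5 * a - 4 * a ^ 2) ^ 2 < 1.29625 ^ 2 := by
      apply pow_lt_pow_left₀ <;> linarith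
    rw [e]
    linarith
  have h₂ : 0.2 < g a 1 := by simp only [g]; nlinarith
  have h₃ : 0.2 < g 1 1 := by simp only [g]; nlinarith
  have hQ : 0 ≤ 25 * ((1 + 4 * a) ^ 2 - 16 * a) + 27 * (3 - 4 * a) ^ 2 := by nlinarith
  have key : (1 - a) * g Y Z = (1 - Z) * g a a + (Z - Y) * g a 1 + (Y - a) * g 1 1
      + (1 - a) * (52 * ((1 - Z) * (Z - Y))
        + (25 * (4 * a) ^ 2 + 27 * (2 - 4 * a) ^ 2) * ((Z - Y) * (Y - a))
        + (25 * ((1 + 4 * a) ^ 2 - 16 * a) + 27 * (3 - 4 * a) ^ 2)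
          * ((1 - Z) * (Y - a))) := by
    simp only [g]; ring
  have hd : 0 < 1 - a := by linarith
  have hu : 0 ≤ Y - a := by linarith
  have hv : 0 ≤ Z - Y := by linarith
  have hw : 0 ≤ 1 - Z := by linarith
  have hrest : 0 ≤ (1 - a) * (52 * ((1 - Z) * (Z - Y))
        + (25 * (4 * a) ^ 2 + 27 * (2 - 4 * a) ^ 2) * ((Z - Y) * (Y - a))
        + (25 * ((1 + 4 * a) ^ 2 - 16 * a) + 27 * (3 - 4 * a) ^ 2)
          * ((1 - Z) * (Y - a))) := by positivity
  obtain ⟨m, hm, hm₁, hm₂, hm₃⟩ : ∃ m, 0.2 < m ∧ m ≤ g a a ∧ m ≤ g a 1 ∧ m ≤ g 1 1 :=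
    ⟨min (g a a) (min (g a 1) (g 1 1)), by simp only [lt_min_iff]; exact ⟨h₁, h₂, h₃⟩,
      by simp, by simp, by simp⟩
  have : (1 - a) * m ≤ (1 - a) * g Y Z := by
    linarith [mul_le_mul_of_nonneg_left hm₁ hw, mul_le_mul_of_nonneg_left hm₂ hv,
      mul_le_mul_of_nonneg_left hm₃ hu]
  exact hm.trans_le (le_of_mul_le_mul_left this hd)

/-- Lemma 4.3 (5): for `x = cos(π/9)` and `cos(π/9) ≤ y ≤ z ≤ 1`,
`25((4xyz)² − (z²+4x²y²−1)²) − 27(2y²(1−2x²) + 2x² + z²)² > 0.2`. -/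
theorem lemma43_5 (x y z : ℝ) (hx : x = Real.cos (π / 9))
    (hy : Real.cos (π / 9) ≤ y) (hyz : y ≤ z) (hz : z ≤ 1) :
    0.2 < 25 * ((4 * x * y * z) ^ 2 - (z ^ 2 + 4 * x ^ 2 * y ^ 2 - 1) ^ 2)
      - 27 * (2 * y ^ 2 * (1 - 2 * x ^ 2) + 2 * x ^ 2 + z ^ 2) ^ 2 := by
  obtain ⟨hlo, hhi⟩ := cos_pi_div_nine_sq_bounds
  have hx0 : 0 ≤ cos (π / 9) := cos_nonneg_of_neg_pi_div_two_le_of_le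
    (by linarith [pi_pos]) (by linarith [pi_pos])
  rw [← hx] at hy hlo hhi hx0
  have hy0 := hx0.trans hy
  have h := lt_quadratic_of_mem_triangle hlo hhi (pow_le_pow_left₀ hx0 hy 2)
    (pow_le_pow_left₀ hy0 hyz 2) (pow_le_one₀ (hy0.trans hyz) hz)
  convert h using 1
  ring
end
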